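/- With \phi(s) = s - 1 - \ln s (principal branch) and \gamma an admissible contour (a smooth Jordan curve around 0 coinciding with the steepest descent path \arg s = \mathrm{Im}\,s near s = 1 and otherwise at positive distance from the level set \mathrm{Re}\,\phi = 0), the Cauchy transform F_n(z) = (1/(2\pi i))\int_\gamma e^{n\phi(s)}/(s-z)\,ds satisfies: for every \epsilon > 0 there is C > 0 and N such that for all n \ge N and all z with \mathrm{dist}(z, \gamma) \ge \epsilon and |z - 1| \ge \epsilon, | \sqrt{2\pi n}\,(1-z)\, F_n(z) - 1 | \le C/n. -/

import Mathlib

open Complex MeasureTheory intervalIntegral Filter Topology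

noncomputable section

/-- A smooth Jordan curve in the complex plane, parametrized with period 1. -/
structure SmoothJordanCurve where
  toFun : ℝ → ℂ
  derivFun : ℝ → ℂ
  smooth : ContDiff ℝ (⊤ : ℕ∞) toFun
  hasDeriv : ∀ t, HasDerivAt toFun (derivFun t) t
  periodic : Function.Periodic toFun 1
  injOn : Set.InjOn toFun (Set.Ico 0 1)
  regular : ∀ t, derivFun t ≠ 0

/-- The image (trace) of the curve. -/
def SmoothJordanCurve.image (γ : SmoothJordanCurve) : Set ℂ := Set.range γ.toFun

/-- Contour integral of `f` along the curve. -/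
def SmoothJordanCurve.integral (γ : SmoothJordanCurve) (f : ℂ → ℂ) : ℂ :=
  ∫ t in (0:ℝ)..1, f (γ.toFun t) * γ.derivFun t

/-- Winding number of the curve around a point `z`. -/
def SmoothJordanCurve.winding (γ : SmoothJordanCurve) (z : ℂ) : ℂ :=
  (1 / (2 * Real.pi * I)) * ∫ t in (0:ℝ)..1, γ.derivFun t / (γ.toFun t - z)

/-- The interior of the curve: points off the trace with winding number one. -/
def SmoothJordanCurve.interior (γ : SmoothJordanCurve) : Set ℂ :=
  {z | z ∉ γ.image ∧ γ.winding z = 1}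

/-- The exterior of the curve: points off the trace with winding number zero. -/
def SmoothJordanCurve.exterior (γ : SmoothJordanCurve) : Set ℂ :=
  {z | z ∉ γ.image ∧ γ.winding z = 0}

end
noncomputable section

/-- The steepest descent path of `φ(z) = z - 1 - log z` through `z₀ = 1`:
points `z ≠ 0` with `arg z = Im z`. -/
def steepestDescentSet : Set ℂ := {z | z ≠ 0 ∧ Complex.arg z = z.im}

/-- The level set `Re φ = 0` (the solid curve of Figure 2.1, containing the
Szegő curve). -/
def phiLevelSet : Set ℂ := {z | z ≠ 0 ∧ (z - 1 - Complex.log z).re = 0}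

/-- An admissible contour: a smooth Jordan curve winding counterclockwise
around the origin, coinciding with the steepest descent path in a neighborhood
`U` of `z₀ = 1` and staying at positive distance from the level set
`Re φ = 0` outside `U`. -/
def Admissible (γ : SmoothJordanCurve) : Prop :=
  (0:ℂ) ∉ γ.image ∧ γ.winding 0 = 1 ∧
  ∃ U : Set ℂ, IsOpen U ∧ (1:ℂ) ∈ U ∧ (1:ℂ) ∈ γ.image ∧
    γ.image ∩ U ⊆ steepestDescentSet ∧
    ∃ d > (0:ℝ), ∀ s ∈ γ.image \ U, ∀ w ∈ phiLevelSet, d ≤ dist s w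

/-! ### Helper lemmas -/

/-- The Stirling formula with a rate. -/
lemma aux_stirling (n : ℕ) (hn : 1 ≤ n) :
    |Real.sqrt Real.pi / Stirling.stirlingSeq n - 1| ≤ 1 / (12 * n) := by
  have hpos : ∀ k, 0 < Stirling.stirlingSeq (k + 1) := Stirling.stirlingSeq'_pos
  have hmono : Monotone (fun k : ℕ =>
      Real.log (Stirling.stirlingSeq (k + 1)) - 1 / (12 * ((k : ℝ) + 1))) := by
    apply monotone_nat_of_le_succ
    intro k
    have h := Stirling.log_stirlingSeq_sdiff_le (k + 1)
    have e : (1 : ℝ) / (12 * ((k + 1 : ℕ) : ℝ) * (((k + 1 : ℕ) : ℝ) + 1)) =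
        1 / (12 * ((k : ℝ) + 1)) - 1 / (12 * (((k + 1 : ℕ) : ℝ) + 1)) := by
      push_cast
      field_simp
      ring
    rw [e] at h
    linarith
  have hlim : Tendsto (fun k : ℕ =>
      Real.log (Stirling.stirlingSeq (k + 1)) - 1 / (12 * ((k : ℝ) + 1))) atTop
      (𝓝 (Real.log (Real.sqrt Real.pi) - 0)) := by
    apply Tendsto.sub
    · have h1 := Stirling.tendsto_stirlingSeq_sqrt_pi.comp (tendsto_add_atTop_nat 1)
      exact h1.log (by positivity)
    · have h2 := (tendsto_one_div_add_atTop_nhds_zero_nat (𝕜 := ℝ)).const_mul (1 / 12)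
      rw [mul_zero] at h2
      refine h2.congr fun k => ?_
      field_simp
  obtain ⟨m, rfl⟩ : ∃ m, n = m + 1 := ⟨n - 1, by omega⟩
  have h1 := hmono.ge_of_tendsto hlim m
  simp only [sub_zero] at h1
  have hS := hpos m
  have hpi : 0 < Real.sqrt Real.pi := by positivity
  have h2 : Real.log (Real.sqrt Real.pi / Stirling.stirlingSeq (m + 1)) ≥
      - (1 / (12 * ((m : ℝ) + 1))) := by
    rw [Real.log_div hpi.ne' hS.ne']
    linarith
  have h3 := Real.log_le_sub_one_of_pos (div_pos hpi hS)
  have h4 : Real.sqrt Real.pi / Stirling.stirlingSeq (m + 1) ≤ 1 := by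
    rw [div_le_one hS]
    exact Stirling.sqrt_pi_le_stirlingSeq (by omega)
  push_cast
  rw [abs_le]
  have : 0 ≤ 1 / (12 * ((m : ℝ) + 1)) := by positivity
  constructor <;> linarith

/-- The only point where the steepest descent set meets the level set is `1`. -/
lemma aux_real (r y x : ℝ) (hr : 0 < r) (hy : 0 < y) (hy' : y ≤ Real.pi)
    (h1 : y = r * Real.sin y) (h2 : x = r * Real.cos y) (h3 : x - 1 = Real.log r) : False := by
  have hs : Real.sin y < y := Real.sin_lt hy
  have hs0 : 0 < Real.sin y := by
    by_contra h
    have : r * Real.sin y ≤ 0 := mul_nonpos_of_nonneg_of_nonpos hr.le (not_lt.mp h)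
    linarith
  have hr1 : 1 < r := by
    by_contra h
    have : r * Real.sin y ≤ 1 * Real.sin y := by
      apply mul_le_mul_of_nonneg_right (not_lt.mp h) hs0.le
    linarith
  have hlog : 0 < Real.log r := Real.log_pos hr1
  have hx : 1 < x := by linarith
  have hc : 0 < Real.cos y := by
    by_contra h
    have : r * Real.cos y ≤ 0 := mul_nonpos_of_nonneg_of_nonpos hr.le (not_lt.mp h)
    linarith
  have hy2 : y < Real.pi / 2 := by
    by_contra h
    have := Real.cos_nonpos_of_pi_div_two_le_of_le (not_lt.mp h) (by linarith)
    linarith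
  have ht := Real.lt_tan hy hy2
  rw [Real.tan_eq_sin_div_cos, lt_div_iff₀ hc] at ht
  have : Real.sin y * x = y * Real.cos y := by
    rw [h2, show Real.sin y * (r * Real.cos y) = (r * Real.sin y) * Real.cos y by ring, ← h1]
  nlinarith

lemma aux_inter (z : ℂ) (h1 : z ∈ steepestDescentSet) (h2 : z ∈ phiLevelSet) : z = 1 := by
  obtain ⟨h0, harg⟩ := h1
  obtain ⟨-, hre⟩ := h2
  have hr : 0 < ‖z‖ := norm_pos_iff.mpr h0
  have hre' : z.re - 1 = Real.log ‖z‖ := by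
    simp [Complex.log_re] at hre
    linarith
  have hc := Complex.norm_mul_cos_arg z
  have hs := Complex.norm_mul_sin_arg z
  rw [harg] at hc hs
  have hle := Complex.arg_le_pi z
  have hlt := Complex.neg_pi_lt_arg z
  rw [harg] at hle hlt
  rcases lt_trichotomy z.im 0 with h | h | h
  · exact (aux_real ‖z‖ (-z.im) z.re hr (by linarith) (by linarith)
      (by rw [Real.sin_neg]; linarith) (by rw [Real.cos_neg]; exact hc.symm) hre').elim
  · rw [h] at hc
    simp at hc
    rw [hc] at hre'
    have hx : 0 < z.re := hc ▸ hr
    have : z.re = 1 := by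
      by_contra hne
      have := Real.log_lt_sub_one_of_pos hx hne
      linarith
    apply Complex.ext <;> simp [this, h]
  · exact (aux_real ‖z‖ z.im z.re hr h hle hs.symm hc.symm hre').elim

namespace SmoothJordanCurve

variable (γ : SmoothJordanCurve)

lemma cont : Continuous γ.toFun := γ.smooth.continuous

lemma derivCont : Continuous γ.derivFun := by
  have h : γ.derivFun = deriv γ.toFun := by
    funext t
    exact (γ.hasDeriv t).deriv.symm
  rw [h]
  exact γ.smooth.continuous_deriv (by simp)

lemma mem_image (t : ℝ) : γ.toFun t ∈ γ.image := ⟨t, rfl⟩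

lemma integral_closed (G f : ℂ → ℂ) (hG : ∀ t, HasDerivAt G (f (γ.toFun t)) (γ.toFun t))
    (hf : Continuous fun t => f (γ.toFun t)) : γ.integral f = 0 := by
  unfold SmoothJordanCurve.integral
  have h : ∀ t ∈ Set.uIcc (0:ℝ) 1, HasDerivAt (G ∘ γ.toFun) (f (γ.toFun t) * γ.derivFun t) t := by
    intro t _
    have := (hG t).scomp t (γ.hasDeriv t)
    rwa [smul_eq_mul, mul_comm] at this
  rw [integral_eq_sub_of_hasDerivAt h ((hf.mul γ.derivCont).intervalIntegrable _ _)]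
  have := γ.periodic 0
  rw [zero_add] at this
  simp [this]

lemma integral_sub (f g : ℂ → ℂ) (hf : Continuous fun t => f (γ.toFun t))
    (hg : Continuous fun t => g (γ.toFun t)) :
    γ.integral (fun s => f s - g s) = γ.integral f - γ.integral g := by
  unfold SmoothJordanCurve.integral
  have h1 : IntervalIntegrable (fun t => f (γ.toFun t) * γ.derivFun t) volume 0 1 :=
    (hf.mul γ.derivCont).intervalIntegrable _ _
  have h2 : IntervalIntegrable (fun t => g (γ.toFun t) * γ.derivFun t) volume 0 1 :=
    (hg.mul γ.derivCont).intervalIntegrable _ _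
  rw [← intervalIntegral.integral_sub h1 h2]
  simp only [sub_mul]

lemma integral_const_mul (c : ℂ) (f : ℂ → ℂ) :
    γ.integral (fun s => c * f s) = c * γ.integral f := by
  unfold SmoothJordanCurve.integral
  rw [← intervalIntegral.integral_const_mul]
  simp only [mul_assoc]

lemma integral_congr (f g : ℂ → ℂ) (h : ∀ t, f (γ.toFun t) = g (γ.toFun t)) :
    γ.integral f = γ.integral g := by
  unfold SmoothJordanCurve.integral
  simp only [h]


lemma ne_zero (h0 : (0:ℂ) ∉ γ.image) (t : ℝ) : γ.toFun t ≠ 0 := fun h => h0 ⟨t, h⟩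

end SmoothJordanCurve

namespace SmoothJordanCurve

variable (γ : SmoothJordanCurve)

lemma winding_exp (h0 : (0:ℂ) ∉ γ.image) (hw : γ.winding 0 = 1) (a : ℂ) :
    γ.integral (fun s => Complex.exp (a * s) / s) = 2 * Real.pi * I := by
  have hne := γ.ne_zero h0
  have hd : Differentiable ℂ (dslope (fun s => Complex.exp (a * s)) 0) := by
    intro s
    have h1 : DifferentiableOn ℂ (fun s => Complex.exp (a * s)) Set.univ := by fun_prop
    exact ((Complex.differentiableOn_dslope (c := 0) Filter.univ_mem).mpr h1).differentiableAt
      Filter.univ_mem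
  obtain ⟨G, hG⟩ := hd.isExactOn_univ
  have hz := γ.integral_closed G _ (fun t => hG _ (Set.mem_univ _)) (hd.continuous.comp γ.cont)
  have hc : Continuous γ.toFun := γ.cont
  have e : γ.integral (dslope (fun s => Complex.exp (a * s)) 0) =
      γ.integral (fun s => Complex.exp (a * s) / s - 1 / s) := by
    apply γ.integral_congr
    intro t
    rw [dslope_of_ne _ (hne t), slope_def_field]
    simp [sub_div]
  have hcont1 : Continuous fun t => Complex.exp (a * γ.toFun t) / γ.toFun t :=
    (by fun_prop : Continuous fun t => Complex.exp (a * γ.toFun t)).div hc hne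
  have hcont2 : Continuous fun t => 1 / γ.toFun t := continuous_const.div hc hne
  rw [e, γ.integral_sub _ _ hcont1 hcont2, sub_eq_zero] at hz
  rw [hz]
  unfold winding at hw
  unfold SmoothJordanCurve.integral
  simp only [sub_zero] at hw
  have hp : (2 * Real.pi * I : ℂ) ≠ 0 := Complex.two_pi_I_ne_zero
  rw [one_div, inv_mul_eq_iff_eq_mul₀ hp, mul_one] at hw
  rw [← hw]
  apply intervalIntegral.integral_congr
  intro t _
  simp only []
  ring

lemma exp_div_pow (h0 : (0:ℂ) ∉ γ.image) (hw : γ.winding 0 = 1) (a : ℂ) (k : ℕ) :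
    γ.integral (fun s => Complex.exp (a * s) / s ^ (k + 1)) =
      2 * Real.pi * I * (a ^ k / (k.factorial : ℂ)) := by
  have hne := γ.ne_zero h0
  have hc : Continuous γ.toFun := γ.cont
  have hcont : ∀ j : ℕ, Continuous fun t => Complex.exp (a * γ.toFun t) / γ.toFun t ^ j := by
    intro j
    exact (by fun_prop : Continuous fun t => Complex.exp (a * γ.toFun t)).div (hc.pow j)
      (fun t => pow_ne_zero _ (hne t))
  induction k with
  | zero => simpa using γ.winding_exp h0 hw a
  | succ k ih =>
    have hz := γ.integral_closed (fun s => Complex.exp (a * s) / s ^ (k + 1))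
      (fun s => a * (Complex.exp (a * s) / s ^ (k + 1)) -
        (k + 1 : ℂ) * (Complex.exp (a * s) / s ^ (k + 1 + 1))) ?_ ?_
    · rw [γ.integral_sub _ _ ((hcont _).const_smul a) ((hcont _).const_smul (k + 1 : ℂ)),
        γ.integral_const_mul, γ.integral_const_mul, ih, sub_eq_zero] at hz
      have hk : (k + 1 : ℂ) ≠ 0 := Nat.cast_add_one_ne_zero k
      have hf : (k.factorial : ℂ) ≠ 0 := by exact_mod_cast k.factorial_ne_zero
      apply mul_left_cancel₀ hk
      rw [← hz, Nat.factorial_succ]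
      push_cast
      field_simp
      ring
    · intro t
      have hs := hne t
      have h1 : HasDerivAt (fun s : ℂ => Complex.exp (a * s))
          (Complex.exp (a * γ.toFun t) * (a * 1)) (γ.toFun t) :=
        ((hasDerivAt_id (γ.toFun t)).const_mul a).cexp
      have h2 := h1.div (hasDerivAt_pow (k + 1) (γ.toFun t)) (pow_ne_zero _ hs)
      refine h2.congr_deriv ?_
      rw [Nat.add_sub_cancel]
      push_cast
      field_simp
      ring
    · exact ((hcont _).const_smul a).sub ((hcont _).const_smul (k + 1 : ℂ))

/-- The function `e^{nφ}`. -/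
def En (n : ℕ) (s : ℂ) : ℂ := Complex.exp ((n : ℂ) * (s - 1)) / s ^ n

lemma En_cont (h0 : (0:ℂ) ∉ γ.image) (n : ℕ) : Continuous fun t => En n (γ.toFun t) := by
  have hne := γ.ne_zero h0
  have hc : Continuous γ.toFun := γ.cont
  exact (by fun_prop : Continuous fun t => Complex.exp ((n : ℂ) * (γ.toFun t - 1))).div (hc.pow n)
      (fun t => pow_ne_zero _ (hne t))

lemma En_eq (n : ℕ) (s : ℂ) (hs : s ≠ 0) :
    Complex.exp ((n:ℂ) * (s - 1 - Complex.log s)) = En n s := by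
  unfold En
  rw [mul_sub, Complex.exp_sub, Complex.exp_nat_mul (Complex.log s), Complex.exp_log hs]

lemma En_integral (h0 : (0:ℂ) ∉ γ.image) (hw : γ.winding 0 = 1) (n : ℕ) (hn : 1 ≤ n) :
    (Real.sqrt (2 * Real.pi * n) : ℂ) * (1 / (2 * Real.pi * I) * γ.integral (En n)) =
      ((Real.sqrt Real.pi / Stirling.stirlingSeq n : ℝ) : ℂ) := by
  obtain ⟨m, rfl⟩ : ∃ m, n = m + 1 := ⟨n - 1, by omega⟩
  have e : γ.integral (En (m + 1)) = γ.integral (fun s => Complex.exp (-((m + 1 : ℕ) : ℂ)) *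
      (Complex.exp (((m + 1 : ℕ) : ℂ) * s) / s ^ (m + 1))) := by
    apply γ.integral_congr
    intro t
    unfold En
    rw [← mul_div_assoc, ← Complex.exp_add]
    congr 2
    ring
  have hp : (2 * Real.pi * I : ℂ) ≠ 0 := Complex.two_pi_I_ne_zero
  rw [e, γ.integral_const_mul, γ.exp_div_pow h0 hw]
  have e2 : (1 / (2 * Real.pi * I) * (Complex.exp (-((m + 1 : ℕ) : ℂ)) *
      (2 * Real.pi * I * (((m + 1 : ℕ) : ℂ) ^ m / (m.factorial : ℂ)))) : ℂ) =
      ((Real.exp (-((m + 1 : ℕ) : ℝ)) * (((m + 1 : ℕ) : ℝ) ^ m / (m.factorial : ℝ)) : ℝ) : ℂ) := by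
    push_cast
    field_simp
  rw [e2, ← Complex.ofReal_mul, Complex.ofReal_inj]
  unfold Stirling.stirlingSeq
  have e3 : Real.sqrt (2 * Real.pi * ((m + 1 : ℕ) : ℝ)) =
      Real.sqrt Real.pi * Real.sqrt (2 * ((m + 1 : ℕ) : ℝ)) := by
    rw [← Real.sqrt_mul Real.pi_pos.le]
    congr 1
    ring
  have hf : (m.factorial : ℝ) ≠ 0 := by exact_mod_cast m.factorial_ne_zero
  have hm : ((m + 1 : ℕ) : ℝ) ≠ 0 := by positivity
  have hs : Real.sqrt (2 * ((m + 1 : ℕ) : ℝ)) ≠ 0 := by positivity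
  have e4 : Real.exp (-((m + 1 : ℕ) : ℝ)) = (Real.exp 1 ^ (m + 1))⁻¹ := by
    rw [Real.exp_neg, ← Real.exp_nat_mul, mul_one]
  rw [e3, e4, Nat.factorial_succ, div_pow, Nat.cast_mul]
  field_simp
  ring

lemma parts (h0 : (0:ℂ) ∉ γ.image) (n : ℕ) (hn : 1 ≤ n) (z : ℂ) (hz : z ∉ γ.image) :
    (1 - z) * γ.integral (fun s => En n s / (s - z)) =
      γ.integral (En n) - (1 / (n : ℂ)) * γ.integral (fun s => En n s * (z / (s - z) ^ 2)) := by
  have hne := γ.ne_zero h0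
  have hc : Continuous γ.toFun := γ.cont
  have hE := γ.En_cont h0 n
  have hnz : ∀ t, γ.toFun t - z ≠ 0 := fun t h => hz ⟨t, sub_eq_zero.mp h⟩
  have hn0 : (n : ℂ) ≠ 0 := by
    have : n ≠ 0 := by omega
    exact_mod_cast this
  have hc1 : Continuous fun t => En n (γ.toFun t) * ((γ.toFun t - 1) / (γ.toFun t - z)) :=
    hE.mul ((hc.sub continuous_const).div (hc.sub continuous_const) hnz)
  have hc2 : Continuous fun t => En n (γ.toFun t) * (z / (γ.toFun t - z) ^ 2) :=
    hE.mul (continuous_const.div ((hc.sub continuous_const).pow 2)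
      (fun t => pow_ne_zero _ (hnz t)))
  have e1 : (1 - z) * γ.integral (fun s => En n s / (s - z)) =
      γ.integral (En n) - γ.integral (fun s => En n s * ((s - 1) / (s - z))) := by
    rw [← γ.integral_const_mul, ← γ.integral_sub _ _ hE hc1]
    apply γ.integral_congr
    intro t
    have := hnz t
    field_simp
    ring
  have hcl := γ.integral_closed (fun s => En n s * (s / (s - z)))
    (fun s => (n : ℂ) * (En n s * ((s - 1) / (s - z))) - En n s * (z / (s - z) ^ 2)) ?_ ?_
  · rw [γ.integral_sub _ _ (hc1.const_smul (n : ℂ)) hc2, γ.integral_const_mul, sub_eq_zero] at hcl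
    rw [e1, ← hcl]
    field_simp
  · intro t
    have hs := hne t
    have hs2 := hnz t
    have h1 : HasDerivAt (fun s : ℂ => Complex.exp ((n : ℂ) * (s - 1)))
        (Complex.exp ((n : ℂ) * (γ.toFun t - 1)) * ((n : ℂ) * 1)) (γ.toFun t) :=
      (((hasDerivAt_id (γ.toFun t)).sub_const 1).const_mul (n : ℂ)).cexp
    have h2 := h1.div (hasDerivAt_pow n (γ.toFun t)) (pow_ne_zero _ hs)
    have h3 := (hasDerivAt_id (γ.toFun t)).div ((hasDerivAt_id (γ.toFun t)).sub_const z) hs2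
    have h4 := h2.mul h3
    refine h4.congr_deriv ?_
    unfold En
    simp only [id, Pi.div_apply]
    obtain ⟨m, rfl⟩ : ∃ m, n = m + 1 := ⟨n - 1, by omega⟩
    simp only [Nat.add_sub_cancel]
    field_simp
    ring
  · exact (hc1.const_smul (n : ℂ)).sub hc2

end SmoothJordanCurve

namespace SmoothJordanCurve

variable (γ : SmoothJordanCurve)

lemma ne_one (t₀ : ℝ) (ht₀ : γ.toFun t₀ = 1) (t : ℝ) (h0 : 0 < t) (h1 : t < 1) :
    γ.toFun (t₀ + t) ≠ 1 := by
  intro h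
  have hf : ∀ x, γ.toFun (Int.fract x) = γ.toFun x := by
    intro x
    have := γ.periodic.sub_int_mul_eq (x := x) ⌊x⌋
    rwa [mul_one] at this
  have hI : ∀ x : ℝ, Int.fract x ∈ Set.Ico (0:ℝ) 1 := fun x => ⟨Int.fract_nonneg x, Int.fract_lt_one x⟩
  have heq := γ.injOn (hI (t₀ + t)) (hI t₀) (by rw [hf, hf, h, ht₀])
  obtain ⟨k, hk⟩ := Int.fract_eq_fract.mp heq
  have hk' : t = k := by linarith
  rw [hk'] at h0 h1
  have h0' : 0 < k := by exact_mod_cast h0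
  have h1' : k < 1 := by exact_mod_cast h1
  omega

end SmoothJordanCurve

lemma aux_phi_lim : Tendsto (fun s : ℂ => (s - 1 - Complex.log s) / (s - 1) ^ 2) (𝓝[≠] 1)
    (𝓝 (1 / 2)) := by
  have hO := Complex.log_sub_logTaylor_isBigO 2
  have ho : (fun z : ℂ => Complex.log (1 + z) - Complex.logTaylor 3 z) =o[𝓝 0]
      fun z => z ^ 2 :=
    hO.trans_isLittleO (Asymptotics.isLittleO_pow_pow (by norm_num))
  have h1 := ho.tendsto_div_nhds_zero
  have hs : Tendsto (fun s : ℂ => s - 1) (𝓝[≠] 1) (𝓝 0) := by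
    have : Tendsto (fun s : ℂ => s - 1) (𝓝 1) (𝓝 (1 - 1)) :=
      (continuous_id.sub continuous_const).tendsto 1
    rw [sub_self] at this
    exact this.mono_left nhdsWithin_le_nhds
  have h2 := (h1.comp hs).const_sub (1 / 2 : ℂ)
  rw [sub_zero] at h2
  refine h2.congr' ?_
  filter_upwards [self_mem_nhdsWithin] with s hs
  have hs' : s - 1 ≠ 0 := sub_ne_zero.mpr hs
  simp only [Function.comp, Complex.logTaylor_succ, Complex.logTaylor_zero]
  rw [show 1 + (s - 1) = s by ring]
  field_simp
  norm_num
  ring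

namespace SmoothJordanCurve

variable (γ : SmoothJordanCurve)

lemma phi_lim (t₀ : ℝ) (ht₀ : γ.toFun t₀ = 1) :
    Tendsto (fun t : ℝ => (γ.toFun (t₀ + t) - 1 - Complex.log (γ.toFun (t₀ + t))) / (t : ℂ) ^ 2)
      (𝓝[≠] 0) (𝓝 ((γ.derivFun t₀) ^ 2 / 2)) := by
  have hd : HasDerivAt (fun t : ℝ => γ.toFun (t₀ + t)) (γ.derivFun t₀) 0 := by
    have := γ.hasDeriv (t₀ + 0)
    rw [add_zero] at this
    exact HasDerivAt.comp_const_add t₀ 0 (by simpa using this)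
  have hsl := hd.tendsto_slope_zero
  simp only [zero_add, add_zero, ht₀] at hsl
  have hne : ∀ᶠ t : ℝ in 𝓝[≠] 0, γ.toFun (t₀ + t) ≠ 1 := by
    have := hd.eventually_ne (c := 1) (γ.regular t₀)
    simpa using this
  have hcont : Tendsto (fun t : ℝ => γ.toFun (t₀ + t)) (𝓝[≠] 0) (𝓝[≠] 1) := by
    apply tendsto_nhdsWithin_of_tendsto_nhds_of_eventually_within
    · have := hd.continuousAt.tendsto
      simp only [add_zero, ht₀] at this
      exact this.mono_left nhdsWithin_le_nhds
    · exact hne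
  have h := (aux_phi_lim.comp hcont).mul (hsl.pow 2)
  rw [show (1 / 2 : ℂ) * γ.derivFun t₀ ^ 2 = γ.derivFun t₀ ^ 2 / 2 by ring] at h
  refine h.congr' ?_
  filter_upwards [hne, self_mem_nhdsWithin] with t h1 h2
  have h1' : γ.toFun (t₀ + t) - 1 ≠ 0 := sub_ne_zero.mpr h1
  have h2' : (t : ℂ) ≠ 0 := by exact_mod_cast h2
  simp only [Function.comp, Complex.real_smul, Complex.ofReal_inv]
  field_simp

/-- The real part of `φ` along the curve. -/
def u (t : ℝ) : ℝ := (γ.toFun t - 1 - Complex.log (γ.toFun t)).re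

lemma u_eq (t : ℝ) : γ.u t = (γ.toFun t).re - 1 - Real.log ‖γ.toFun t‖ := by
  simp [u, Complex.log_re]

lemma u_cont (h0 : (0:ℂ) ∉ γ.image) : Continuous γ.u := by
  have hne := γ.ne_zero h0
  have : γ.u = fun t => (γ.toFun t).re - 1 - Real.log ‖γ.toFun t‖ := by
    funext t
    exact γ.u_eq t
  rw [this]
  have hc := γ.cont
  exact ((Complex.continuous_re.comp hc).sub continuous_const).sub
    (hc.norm.log fun t => norm_ne_zero_iff.mpr (hne t))

lemma u_periodic : Function.Periodic γ.u 1 := by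
  intro t
  unfold u
  rw [γ.periodic t]

lemma u_ne (hγ : Admissible γ) (t₀ : ℝ) (ht₀ : γ.toFun t₀ = 1) (t : ℝ) (h0 : 0 < t)
    (h1 : t < 1) : γ.u (t₀ + t) ≠ 0 := by
  intro hu
  obtain ⟨hz, -, U, hU, h1U, -, hsub, d, hd, hdist⟩ := hγ
  have hl : γ.toFun (t₀ + t) ∈ phiLevelSet := ⟨γ.ne_zero hz _, hu⟩
  by_cases hm : γ.toFun (t₀ + t) ∈ U
  · exact γ.ne_one t₀ ht₀ t h0 h1 (aux_inter _ (hsub ⟨γ.mem_image _, hm⟩) hl)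
  · have := hdist _ ⟨γ.mem_image (t₀ + t), hm⟩ _ hl
    rw [dist_self] at this
    linarith

/-- A continuous nonvanishing function on `(0,1)` keeps its sign. -/
lemma sign_aux (f : ℝ → ℝ) (hf : Continuous f) (hne : ∀ t, 0 < t → t < 1 → f t ≠ 0)
    (a : ℝ) (ha0 : 0 < a) (ha1 : a < 1) (ha : 0 < f a) (b : ℝ) (hb0 : 0 < b) (hb1 : b < 1) :
    0 < f b := by
  by_contra h
  have hp : IsPreconnected (Set.Ioo (0:ℝ) 1) := isPreconnected_Ioo
  obtain ⟨c, hc, hc0⟩ := hp.intermediate_value (a := b) (b := a) ⟨hb0, hb1⟩ ⟨ha0, ha1⟩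
    hf.continuousOn ⟨not_lt.mp h, ha.le⟩
  exact hne c hc.1 hc.2 hc0

lemma dsq_im (hγ : Admissible γ) (t₀ : ℝ) (ht₀ : γ.toFun t₀ = 1) :
    ((γ.derivFun t₀) ^ 2 / 2).im = 0 := by
  obtain ⟨hz, -, U, hU, h1U, -, hsub, -⟩ := hγ
  have hl := (Complex.continuous_im.tendsto _).comp (γ.phi_lim t₀ ht₀)
  have hev : ∀ᶠ t : ℝ in 𝓝[≠] 0, γ.toFun (t₀ + t) ∈ U := by
    have hc : Continuous fun t : ℝ => γ.toFun (t₀ + t) := γ.cont.comp (continuous_const.add continuous_id)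
    have := hc.tendsto 0
    simp only [add_zero, ht₀] at this
    exact (this.eventually (hU.mem_nhds h1U)).filter_mono nhdsWithin_le_nhds
  refine tendsto_nhds_unique hl (tendsto_const_nhds.congr' ?_)
  filter_upwards [hev] with t ht
  have := (hsub ⟨γ.mem_image (t₀ + t), ht⟩).2
  simp only [Function.comp]
  rw [← Complex.ofReal_pow, Complex.div_ofReal_im]
  simp [Complex.log_im, this]

lemma u_lim (t₀ : ℝ) (ht₀ : γ.toFun t₀ = 1) :
    Tendsto (fun t : ℝ => γ.u (t₀ + t) / t ^ 2) (𝓝[≠] 0) (𝓝 ((γ.derivFun t₀) ^ 2 / 2).re) := by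
  have hl := (Complex.continuous_re.tendsto _).comp (γ.phi_lim t₀ ht₀)
  refine hl.congr fun t => ?_
  simp only [Function.comp]
  rw [← Complex.ofReal_pow, Complex.div_ofReal_re]
  rfl

lemma dsq_re_neg (hγ : Admissible γ) (t₀ : ℝ) (ht₀ : γ.toFun t₀ = 1) :
    ((γ.derivFun t₀) ^ 2 / 2).re < 0 := by
  have him := γ.dsq_im hγ t₀ ht₀
  have hreg := γ.regular t₀
  have h0 := hγ.1
  by_contra hcon
  have hne : ((γ.derivFun t₀) ^ 2 / 2).re ≠ 0 := by
    intro h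
    have : (γ.derivFun t₀) ^ 2 / 2 = 0 := Complex.ext h him
    simp [hreg] at this
  have hpos : 0 < ((γ.derivFun t₀) ^ 2 / 2).re := lt_of_le_of_ne (not_lt.mp hcon) hne.symm
  set w := γ.derivFun t₀ with hw
  -- the tangent is horizontal
  have e1 : (w ^ 2 / 2).re = (w.re ^ 2 - w.im ^ 2) / 2 := by
    rw [show (2 : ℂ) = ((2 : ℝ) : ℂ) by norm_num, Complex.div_ofReal_re]
    simp [sq]
  have e2 : (w ^ 2 / 2).im = w.re * w.im := by
    rw [show (w ^ 2 / 2 : ℂ) = w ^ 2 / ((2 : ℝ) : ℂ) by norm_num, Complex.div_ofReal_im]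
    simp [sq]
    ring
  rw [e1] at hpos
  rw [e2] at him
  have hwre : w.re ≠ 0 := by
    intro h
    rw [h] at hpos
    nlinarith [sq_nonneg w.im]
  -- `u` is positive on `(0, 1)`
  have hcu : Continuous fun t => γ.u (t₀ + t) :=
    (γ.u_cont h0).comp (continuous_const.add continuous_id)
  have hlim := γ.u_lim t₀ ht₀
  rw [← hw, e1] at hlim
  have hev := hlim.eventually (lt_mem_nhds hpos)
  have hev' : ∀ᶠ t in 𝓝[>] (0:ℝ), 0 < γ.u (t₀ + t) / t ^ 2 :=
    hev.filter_mono (nhdsWithin_mono _ fun x hx => ne_of_gt hx)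
  obtain ⟨a, ha, ha0, ha1⟩ := (hev'.and (Ioo_mem_nhdsGT (zero_lt_one (α := ℝ)))).exists
  have hua : 0 < γ.u (t₀ + a) := by
    have : 0 < a ^ 2 := by positivity
    exact (div_pos_iff_of_pos_right this).mp ha
  have hup : ∀ b, 0 < b → b < 1 → 0 < γ.u (t₀ + b) :=
    fun b hb0 hb1 => sign_aux _ hcu (fun t h h' => γ.u_ne hγ t₀ ht₀ t h h') a ha0 ha1 hua b hb0 hb1

  have hre : ∀ b, 0 < b → b < 1 → (γ.toFun (t₀ + b)).re - 1 ≠ 0 := by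
    intro b hb0 hb1 h
    have h1 := hup b hb0 hb1
    rw [u_eq, h] at h1
    have h2 : 1 ≤ ‖γ.toFun (t₀ + b)‖ := by
      have := Complex.re_le_norm (γ.toFun (t₀ + b))
      linarith
    have := Real.log_nonneg h2
    linarith
  have hcr : Continuous fun t => (γ.toFun (t₀ + t)).re - 1 :=
    (Complex.continuous_re.comp (γ.cont.comp (continuous_const.add continuous_id))).sub
      continuous_const
  -- slope of the real part
  have hd : HasDerivAt (fun t : ℝ => (γ.toFun (t₀ + t)).re) w.re 0 := by
    have h1 : HasDerivAt (fun t : ℝ => γ.toFun (t₀ + t)) w 0 :=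
      HasDerivAt.comp_const_add t₀ 0 (by simpa using γ.hasDeriv t₀)
    exact (Complex.reCLM.hasFDerivAt.comp_hasDerivAt (0:ℝ) h1)
  have hsl := hd.tendsto_slope_zero
  simp only [zero_add, add_zero, ht₀, Complex.one_re, smul_eq_mul] at hsl
  have hsl2 : Tendsto (fun t : ℝ => w.re * (t⁻¹ * ((γ.toFun (t₀ + t)).re - 1))) (𝓝[≠] 0)
    (𝓝 (w.re * w.re)) := hsl.const_mul _
  have hww : 0 < w.re * w.re := mul_self_pos.mpr hwre
  have hevs := hsl2.eventually (lt_mem_nhds hww)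
  obtain ⟨p, hp, hp0, hp1⟩ := ((hevs.filter_mono (nhdsWithin_mono (0:ℝ) (s := Set.Ioi 0)
    fun x hx => ne_of_gt hx)).and (Ioo_mem_nhdsGT (zero_lt_one (α := ℝ)))).exists
  obtain ⟨q, hq, hq0, hq1⟩ := ((hevs.filter_mono (nhdsWithin_mono (0:ℝ) (s := Set.Iio 0)
    fun x hx => ne_of_lt hx)).and (Ioo_mem_nhdsLT (show (-1:ℝ) < 0 by norm_num))).exists
  have hper : γ.toFun (t₀ + q) = γ.toFun (t₀ + (q + 1)) := by
    rw [← add_assoc, γ.periodic]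
  have hf : Continuous fun t => w.re * ((γ.toFun (t₀ + t)).re - 1) := continuous_const.mul hcr
  have hfne : ∀ t, 0 < t → t < 1 → w.re * ((γ.toFun (t₀ + t)).re - 1) ≠ 0 :=
    fun t h h' => mul_ne_zero hwre (hre t h h')
  have hp' : 0 < w.re * ((γ.toFun (t₀ + p)).re - 1) := by
    have : w.re * ((γ.toFun (t₀ + p)).re - 1) =
        p * (w.re * (p⁻¹ * ((γ.toFun (t₀ + p)).re - 1))) := by
      field_simp
    rw [this]
    positivity
  have hq' := sign_aux _ hf hfne p hp0 hp1 hp' (q + 1) (by linarith) (by linarith)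
  rw [← hper] at hq'
  have : w.re * ((γ.toFun (t₀ + q)).re - 1) =
      q * (w.re * (q⁻¹ * ((γ.toFun (t₀ + q)).re - 1))) := by
    have : q ≠ 0 := by linarith
    field_simp
  rw [this] at hq'
  nlinarith

lemma u_bound (hγ : Admissible γ) (t₀ : ℝ) (ht₀ : γ.toFun t₀ = 1) :
    ∃ c > 0, ∀ t ∈ Set.Icc (-(1/2) : ℝ) (1/2), γ.u (t₀ + t) ≤ -c * t ^ 2 := by
  have h0 := hγ.1
  have hneg := γ.dsq_re_neg hγ t₀ ht₀
  have hlim := γ.u_lim t₀ ht₀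
  set κ := ((γ.derivFun t₀) ^ 2 / 2).re
  have hcu : Continuous fun t => γ.u (t₀ + t) :=
    (γ.u_cont h0).comp (continuous_const.add continuous_id)
  have hev := hlim.eventually (gt_mem_nhds (show κ < κ / 2 by linarith))
  -- `u` is negative off `0`
  have hun : ∀ b, 0 < b → b < 1 → 0 < - γ.u (t₀ + b) := by
    have hev' : ∀ᶠ t in 𝓝[>] (0:ℝ), γ.u (t₀ + t) / t ^ 2 < κ / 2 :=
      hev.filter_mono (nhdsWithin_mono _ fun x hx => ne_of_gt hx)
    obtain ⟨a, ha, ha0, ha1⟩ := (hev'.and (Ioo_mem_nhdsGT (zero_lt_one (α := ℝ)))).exists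
    have hua : 0 < - γ.u (t₀ + a) := by
      have h2 : 0 < a ^ 2 := by positivity
      rw [div_lt_iff₀ h2] at ha
      nlinarith
    intro b hb0 hb1
    exact sign_aux (fun t => - γ.u (t₀ + t)) hcu.neg
      (fun t h h' => neg_ne_zero.mpr (γ.u_ne hγ t₀ ht₀ t h h')) a ha0 ha1 hua b hb0 hb1
  have hun' : ∀ t ∈ Set.Icc (-(1/2) : ℝ) (1/2), t ≠ 0 → γ.u (t₀ + t) < 0 := by
    intro t ht htn
    rcases lt_or_gt_of_ne htn with h | h
    · have := hun (t + 1) (by linarith [ht.1]) (by linarith)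
      rw [← add_assoc, γ.u_periodic] at this
      linarith
    · have := hun t h (by linarith [ht.2])
      linarith
  obtain ⟨δ, hδ, hball⟩ := Metric.mem_nhdsWithin_iff.mp hev
  have hu0 : γ.u t₀ = 0 := by simp [u, ht₀]
  -- compact remainder
  have hK : IsCompact (Set.Icc (-(1/2) : ℝ) (1/2) \ Metric.ball 0 δ) :=
    isCompact_Icc.diff Metric.isOpen_ball
  obtain ⟨m, hm, hmb⟩ : ∃ m > 0, ∀ t ∈ Set.Icc (-(1/2) : ℝ) (1/2) \ Metric.ball 0 δ,
      γ.u (t₀ + t) ≤ -m := by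
    rcases (Set.Icc (-(1/2) : ℝ) (1/2) \ Metric.ball 0 δ).eq_empty_or_nonempty with he | hn
    · exact ⟨1, one_pos, fun t ht => by rw [he] at ht; exact ht.elim⟩
    · obtain ⟨x, hx, hmax⟩ := hK.exists_isMaxOn hn hcu.continuousOn
      refine ⟨-γ.u (t₀ + x), ?_, fun t ht => ?_⟩
      · have : x ≠ 0 := by
          rintro rfl
          exact hx.2 (Metric.mem_ball_self hδ)
        linarith [hun' x hx.1 this]
      · rw [neg_neg]
        exact hmax ht
  refine ⟨min (-κ / 2) m, lt_min (by linarith) hm, fun t ht => ?_⟩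
  have ht2 : t ^ 2 ≤ 1 := by nlinarith [ht.1, ht.2]
  by_cases htz : t = 0
  · simp [htz, hu0]
  have ht0 : 0 < t ^ 2 := by positivity
  by_cases hb : t ∈ Metric.ball (0:ℝ) δ
  · have h1 : γ.u (t₀ + t) / t ^ 2 < κ / 2 := hball ⟨hb, htz⟩
    rw [div_lt_iff₀ ht0] at h1
    have := mul_le_mul_of_nonneg_right (min_le_left (-κ / 2) m) ht0.le
    linarith
  · have h1 := hmb t ⟨ht, hb⟩
    have := mul_le_mul_of_nonneg_right (min_le_right (-κ / 2) m) ht0.le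
    nlinarith

end SmoothJordanCurve

namespace SmoothJordanCurve

variable (γ : SmoothJordanCurve)

lemma deriv_periodic : Function.Periodic γ.derivFun 1 := by
  intro t
  have h1 : HasDerivAt (fun x => γ.toFun (x + 1)) (γ.derivFun (t + 1)) t :=
    HasDerivAt.comp_add_const t 1 (γ.hasDeriv (t + 1))
  have h2 : (fun x => γ.toFun (x + 1)) = γ.toFun := funext γ.periodic
  rw [h2] at h1
  exact h1.unique (γ.hasDeriv t)

lemma periodic_bound (f : ℝ → ℂ) (hf : Continuous f) (hp : Function.Periodic f 1) :
    ∃ M, ∀ t, ‖f t‖ ≤ M := by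
  obtain ⟨M, hM⟩ := (isCompact_Icc (a := (0:ℝ)) (b := 1)).exists_bound_of_continuousOn
    hf.continuousOn
  refine ⟨M, fun t => ?_⟩
  have := hp.sub_int_mul_eq (x := t) ⌊t⌋
  rw [mul_one] at this
  rw [← this]
  exact hM _ ⟨Int.fract_nonneg t, (Int.fract_lt_one t).le⟩

lemma norm_bound : ∃ M, ∀ t, ‖γ.toFun t‖ ≤ M := periodic_bound _ γ.cont γ.periodic

lemma En_norm (h0 : (0:ℂ) ∉ γ.image) (n : ℕ) (t : ℝ) :
    ‖En n (γ.toFun t)‖ = Real.exp (n * γ.u t) := by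
  rw [← En_eq n _ (γ.ne_zero h0 t), Complex.norm_exp, u]
  congr 1
  rw [← Complex.ofReal_natCast, Complex.re_ofReal_mul]

lemma En_bound (hγ : Admissible γ) (t₀ : ℝ) (ht₀ : γ.toFun t₀ = 1) :
    ∃ A > 0, ∀ n : ℕ, 1 ≤ n → ∀ (g : ℂ → ℂ) (K : ℝ), 0 ≤ K → (∀ t, ‖g (γ.toFun t)‖ ≤ K) →
      ‖γ.integral (fun s => En n s * g s)‖ ≤ K * A / Real.sqrt n := by
  have h0 := hγ.1
  obtain ⟨c, hc, hu⟩ := γ.u_bound hγ t₀ ht₀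
  obtain ⟨D, hD⟩ := periodic_bound _ γ.derivCont γ.deriv_periodic
  have hD0 : 0 < D := (norm_pos_iff.mpr (γ.regular 0)).trans_le (hD 0)
  refine ⟨D * Real.sqrt (Real.pi / c), by positivity, fun n hn g K hK hg => ?_⟩
  have hn0 : (0:ℝ) < n := by exact_mod_cast hn
  set h : ℝ → ℂ := fun t => En n (γ.toFun t) * g (γ.toFun t) * γ.derivFun t with hh
  have hper : Function.Periodic h 1 := by
    intro t
    simp only [hh]
    rw [γ.periodic t, γ.deriv_periodic t]
  have e1 : γ.integral (fun s => En n s * g s) = ∫ t in (-(1/2) : ℝ)..(1/2), h (t₀ + t) := by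
    have h1 := hper.intervalIntegral_add_eq 0 (t₀ + -(1/2))
    rw [intervalIntegral.integral_comp_add_left (fun x => h x) t₀]
    rw [zero_add, show t₀ + -(1/2) + 1 = t₀ + 1/2 by ring] at h1
    exact h1
  rw [e1]
  have hb : (0:ℝ) < n * c := by positivity
  have hint : Integrable (fun x : ℝ => Real.exp (-(n * c) * x ^ 2)) := integrable_exp_neg_mul_sq hb
  have hle : ‖∫ t in (-(1/2) : ℝ)..(1/2), h (t₀ + t)‖ ≤
      ∫ t in (-(1/2) : ℝ)..(1/2), K * D * Real.exp (-(n * c) * t ^ 2) := by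
    apply intervalIntegral.norm_integral_le_of_norm_le (by norm_num)
    · filter_upwards with t ht
      have hut := hu t ⟨ht.1.le, ht.2⟩
      simp only [hh]
      rw [norm_mul, norm_mul, γ.En_norm h0]
      have h2 : Real.exp (n * γ.u (t₀ + t)) ≤ Real.exp (-(n * c) * t ^ 2) := by
        apply Real.exp_le_exp.mpr
        have := mul_le_mul_of_nonneg_left hut hn0.le
        linarith
      calc _ ≤ Real.exp (-(n * c) * t ^ 2) * K * D := by
            gcongr
            · exact hg _
            · exact hD _
        _ = _ := by ring
    · exact (hint.const_mul _).intervalIntegrable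
  refine hle.trans ?_
  rw [intervalIntegral.integral_const_mul, intervalIntegral.integral_of_le (by norm_num)]
  have h3 : ∫ x in Set.Ioc (-(1/2) : ℝ) (1/2), Real.exp (-(n * c) * x ^ 2) ≤
      ∫ x, Real.exp (-(n * c) * x ^ 2) :=
    setIntegral_le_integral hint (Eventually.of_forall fun x => (Real.exp_pos _).le)
  rw [integral_gaussian] at h3
  have e2 : Real.sqrt (Real.pi / (n * c)) = Real.sqrt (Real.pi / c) / Real.sqrt n := by
    rw [← Real.sqrt_div' _ hn0.le]
    congr 1
    field_simp
  rw [e2] at h3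
  calc _ ≤ K * D * (Real.sqrt (Real.pi / c) / Real.sqrt n) := by gcongr
    _ = _ := by ring

end SmoothJordanCurve

/-- leading-order uniform asymptotics of `F_n` away from the
critical point `z₀ = 1` (Theorem 2.1 of the paper). -/
theorem Fn_asymptotics_away_from_critical_point
    (γ : SmoothJordanCurve) (hγ : Admissible γ)
    (F : ℕ → ℂ → ℂ)
    (hF : ∀ n : ℕ, ∀ z ∉ γ.image, F n z =
      (1 / (2 * Real.pi * I)) *
        γ.integral (fun s =>
          Complex.exp ((n:ℂ) * (s - 1 - Complex.log s)) / (s - z))) :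
    ∀ ε > (0:ℝ), ∃ C > (0:ℝ), ∃ N : ℕ, ∀ n ≥ N, ∀ z : ℂ,
      (∀ s ∈ γ.image, ε ≤ dist z s) → ε ≤ dist z 1 →
      ‖(Real.sqrt (2 * Real.pi * n) : ℂ) * (1 - z) * F n z - 1‖ ≤ C / n := by
  have h0 := hγ.1
  have hw := hγ.2.1
  obtain ⟨t₀, ht₀⟩ : (1:ℂ) ∈ γ.image := by
    obtain ⟨-, -, U, -, -, h, -⟩ := hγ
    exact h
  obtain ⟨A, hA, hAb⟩ := γ.En_bound hγ t₀ ht₀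
  obtain ⟨M, hM⟩ := γ.norm_bound
  have hM0 : 0 ≤ M := (norm_nonneg _).trans (hM 0)
  intro ε hε
  set K : ℝ := M / ε ^ 2 + 1 / ε with hK
  have hK0 : 0 ≤ K := by positivity
  refine ⟨1 / 12 + Real.sqrt (2 * Real.pi) * (1 / (2 * Real.pi)) * (K * A), by positivity, 1, ?_⟩
  intro n hn z hz _
  have hzi : z ∉ γ.image := by
    intro h
    have := hz z h
    rw [dist_self] at this
    linarith
  have hn0 : (0:ℝ) < n := by exact_mod_cast hn
  have e1 : γ.integral (fun s => Complex.exp ((n:ℂ) * (s - 1 - Complex.log s)) / (s - z)) =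
      γ.integral (fun s => SmoothJordanCurve.En n s / (s - z)) := by
    apply γ.integral_congr
    intro t
    rw [SmoothJordanCurve.En_eq n _ (γ.ne_zero h0 t)]
  have hKb : ∀ t, ‖z / (γ.toFun t - z) ^ 2‖ ≤ K := by
    intro t
    have hd : ε ≤ ‖γ.toFun t - z‖ := by
      have := hz _ (γ.mem_image t)
      rwa [dist_comm, dist_eq_norm] at this
    have hd0 : 0 < ‖γ.toFun t - z‖ := by linarith
    have hzn : ‖z‖ ≤ M + ‖γ.toFun t - z‖ := by
      have h1 : ‖z‖ = ‖γ.toFun t - (γ.toFun t - z)‖ := by congr 1; ring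
      rw [h1]
      exact (norm_sub_le _ _).trans (by linarith [hM t])
    rw [norm_div, norm_pow]
    calc ‖z‖ / ‖γ.toFun t - z‖ ^ 2 ≤ (M + ‖γ.toFun t - z‖) / ‖γ.toFun t - z‖ ^ 2 := by gcongr
      _ = M / ‖γ.toFun t - z‖ ^ 2 + 1 / ‖γ.toFun t - z‖ := by field_simp
      _ ≤ K := by
        rw [hK]
        gcongr
  have hI := hAb n hn (fun s => z / (s - z) ^ 2) K hK0 hKb
  have e2 : (Real.sqrt (2 * Real.pi * n) : ℂ) * (1 - z) * F n z - 1 =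
      ((Real.sqrt Real.pi / Stirling.stirlingSeq n - 1 : ℝ) : ℂ) -
      (Real.sqrt (2 * Real.pi * n) : ℂ) * (1 / (2 * Real.pi * I)) * (1 / (n : ℂ)) *
        γ.integral (fun s => SmoothJordanCurve.En n s * (z / (s - z) ^ 2)) := by
    rw [hF n z hzi, e1, Complex.ofReal_sub, ← γ.En_integral h0 hw n hn]
    have := γ.parts h0 n hn z hzi
    push_cast
    linear_combination (Real.sqrt (2 * Real.pi * n) : ℂ) * (1 / (2 * Real.pi * I)) * this
  rw [e2]
  refine (norm_sub_le _ _).trans ?_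
  rw [Complex.norm_real, Real.norm_eq_abs]
  have h1 := aux_stirling n hn
  have e3 : ‖(Real.sqrt (2 * Real.pi * n) : ℂ) * (1 / (2 * Real.pi * I)) * (1 / (n : ℂ)) *
        γ.integral (fun s => SmoothJordanCurve.En n s * (z / (s - z) ^ 2))‖ =
      Real.sqrt (2 * Real.pi) * Real.sqrt n * (1 / (2 * Real.pi)) * (1 / n) *
        ‖γ.integral (fun s => SmoothJordanCurve.En n s * (z / (s - z) ^ 2))‖ := by
    rw [norm_mul, norm_mul, norm_mul, Complex.norm_real, Real.norm_eq_abs,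
      abs_of_nonneg (Real.sqrt_nonneg _), Real.sqrt_mul (by positivity)]
    simp [abs_of_pos Real.pi_pos]
  rw [e3]
  have hs : 0 < Real.sqrt n := Real.sqrt_pos.mpr hn0
  calc _ ≤ 1 / (12 * (n:ℝ)) + Real.sqrt (2 * Real.pi) * Real.sqrt n * (1 / (2 * Real.pi)) *
        (1 / n) * (K * A / Real.sqrt n) := by gcongr
    _ = _ := by field_simp

end
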